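/- For every a ∈ (0,1) the function Ψ_a has a smallest positive zero μ₁(a), and lim_{a → 0⁺} μ₁(a) · √(|log a|) = 1. -/

import Mathlib

open Real

noncomputable section

/-- Bessel function of the first kind of order 0, via its power series. -/
def J0 (x : ℝ) : ℝ := ∑' k : ℕ, (-1 : ℝ) ^ k * (x / 2) ^ (2 * k) / ((k.factorial : ℝ)) ^ 2

/-- Bessel function of the first kind of order 1, via its power series. -/
def J1 (x : ℝ) : ℝ :=
  ∑' k : ℕ, (-1 : ℝ) ^ k * (x / 2) ^ (2 * k + 1) / ((k.factorial : ℝ) * ((k + 1).factorial : ℝ))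

/-- The transcendental function `Ψ_a(x) = J₀(x) + 2 log(a) x J₁(x)`. -/
def Psi (a x : ℝ) : ℝ := J0 x + 2 * Real.log a * x * J1 x

/-- Power series with coefficients `c`. -/
def PS (c : ℕ → ℝ) (t : ℝ) : ℝ := ∑' k : ℕ, c k * t ^ k

theorem PS_bound (c : ℕ → ℝ) (hc : ∀ k, |c k| ≤ 1 / (k.factorial : ℝ)) (M t : ℝ) (ht : |t| ≤ M)
    (k : ℕ) : ‖c k * t ^ k‖ ≤ M ^ k / (k.factorial : ℝ) := by
  rw [Real.norm_eq_abs, abs_mul, abs_pow]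
  calc |c k| * |t| ^ k ≤ (1 / (k.factorial : ℝ)) * M ^ k := by
        gcongr
        exact hc k
    _ = _ := by ring

theorem PS_summable (c : ℕ → ℝ) (hc : ∀ k, |c k| ≤ 1 / (k.factorial : ℝ)) (t : ℝ) :
    Summable (fun k => c k * t ^ k) :=
  Summable.of_norm_bounded (Real.summable_pow_div_factorial |t|)
    (fun k => PS_bound c hc |t| t le_rfl k)

theorem PS_continuous (c : ℕ → ℝ) (hc : ∀ k, |c k| ≤ 1 / (k.factorial : ℝ)) :
    Continuous (PS c) := by
  rw [continuous_iff_continuousAt]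
  intro x
  have h : ContinuousOn (PS c) (Set.Icc (-(|x| + 1)) (|x| + 1)) := by
    apply continuousOn_tsum (u := fun k => (|x| + 1) ^ k / (k.factorial : ℝ))
    · intro i
      fun_prop
    · exact Real.summable_pow_div_factorial _
    · intro n y hy
      exact PS_bound c hc _ _ (abs_le.mpr hy) n
  apply h.continuousAt
  apply Icc_mem_nhds
  · linarith [neg_abs_le x]
  · linarith [le_abs_self x]

theorem PS_zero (c : ℕ → ℝ) : PS c 0 = c 0 := by
  unfold PS
  rw [tsum_eq_single 0]
  · simp
  · intro k hk
    simp [hk]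

/-- Coefficients of `J₀`. -/
def cF (k : ℕ) : ℝ := (-1) ^ k / ((k.factorial : ℝ)) ^ 2

/-- Coefficients of `J₁`. -/
def cG (k : ℕ) : ℝ := (-1) ^ k / ((k.factorial : ℝ) * ((k + 1).factorial : ℝ))

theorem cF_abs (k : ℕ) : |cF k| = 1 / ((k.factorial : ℝ)) ^ 2 := by
  unfold cF
  rw [abs_div, abs_pow, abs_neg, abs_one, one_pow, abs_of_nonneg (by positivity)]

theorem cG_abs (k : ℕ) : |cG k| = 1 / ((k.factorial : ℝ) * ((k + 1).factorial : ℝ)) := by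
  unfold cG
  rw [abs_div, abs_pow, abs_neg, abs_one, one_pow, abs_of_nonneg (by positivity)]

theorem one_le_fac (k : ℕ) : (1 : ℝ) ≤ (k.factorial : ℝ) := by
  exact_mod_cast Nat.one_le_iff_ne_zero.mpr (Nat.factorial_ne_zero k)

theorem cF_le (k : ℕ) : |cF k| ≤ 1 / (k.factorial : ℝ) := by
  rw [cF_abs]
  have := one_le_fac k
  apply one_div_le_one_div_of_le (by positivity)
  nlinarith

theorem cG_le (k : ℕ) : |cG k| ≤ 1 / (k.factorial : ℝ) := by
  rw [cG_abs]
  have := one_le_fac k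
  have := one_le_fac (k + 1)
  apply one_div_le_one_div_of_le (by positivity)
  nlinarith

theorem J0_eq (x : ℝ) : J0 x = PS cF (x ^ 2 / 4) := by
  unfold J0 PS cF
  congr 1
  funext k
  rw [pow_mul, show (x / 2) ^ 2 = x ^ 2 / 4 by ring]
  ring

theorem J1_eq (x : ℝ) : J1 x = x / 2 * PS cG (x ^ 2 / 4) := by
  unfold J1 PS cG
  rw [← tsum_mul_left]
  congr 1
  funext k
  rw [pow_succ, pow_mul, show (x / 2) ^ 2 = x ^ 2 / 4 by ring]
  ring

theorem Psi_eq (a x : ℝ) :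
    Psi a x = PS cF (x ^ 2 / 4) + Real.log a * x ^ 2 * PS cG (x ^ 2 / 4) := by
  unfold Psi
  rw [J0_eq, J1_eq]
  ring

theorem Psi_continuous (a : ℝ) : Continuous (Psi a) := by
  have h1 := PS_continuous cF cF_le
  have h2 := PS_continuous cG cG_le
  have : Psi a = fun x => PS cF (x ^ 2 / 4) + Real.log a * x ^ 2 * PS cG (x ^ 2 / 4) :=
    funext (Psi_eq a)
  rw [this]
  fun_prop

theorem PS_F_zero : PS cF 0 = 1 := by rw [PS_zero]; simp [cF]

theorem PS_G_zero : PS cG 0 = 1 := by rw [PS_zero]; simp [cG]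

theorem Psi_zero (a : ℝ) : Psi a 0 = 1 := by
  rw [Psi_eq]
  simp [PS_F_zero]

theorem tail_bound (f : ℕ → ℝ) (C : ℝ) (hf : ∀ k, |f k| ≤ C * (1 / 2) ^ k) :
    |∑' k, f k| ≤ C * 2 := by
  have h := tsum_of_norm_bounded (f := f) (hasSum_geometric_two.mul_left C) hf
  exact h

theorem fac_tail (k : ℕ) : (6 : ℝ) * 4 ^ k ≤ ((k + 3).factorial : ℝ) := by
  induction k with
  | zero => norm_num [Nat.factorial]
  | succ n ih =>
    rw [show n + 1 + 3 = (n + 3) + 1 by ring, Nat.factorial_succ (n + 3), pow_succ]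
    push_cast
    nlinarith [one_le_fac (n + 3), (Nat.cast_nonneg n : (0 : ℝ) ≤ n)]

theorem F_two : PS cF 2 ≤ 0 := by
  have h := (PS_summable cF cF_le 2).sum_add_tsum_nat_add 4
  have ht := tail_bound (fun k => cF (k + 4) * 2 ^ (k + 4)) (1 / 36) (by
    intro k
    have h1 := fac_tail (k + 1)
    rw [show k + 1 + 3 = k + 4 by ring, pow_succ] at h1
    rw [abs_mul, cF_abs, abs_of_nonneg (by positivity : (0 : ℝ) ≤ 2 ^ (k + 4))]
    have h4 : (4 : ℝ) ^ k = 2 ^ k * 2 ^ k := by rw [← mul_pow]; norm_num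
    have h2 : (1 : ℝ) ≤ 2 ^ k := one_le_pow₀ (by norm_num)
    have h3 : ((24 : ℝ) * (2 ^ k * 2 ^ k)) ^ 2 ≤ ((k + 4).factorial : ℝ) ^ 2 := by
      gcongr
      linarith
    have h5 : (1 : ℝ) ≤ 2 ^ k * 2 ^ k := by nlinarith
    rw [one_div_pow, pow_add, div_mul_eq_mul_div, div_mul_div_comm,
      div_le_div_iff₀ (by positivity) (by positivity)]
    nlinarith)
  unfold PS
  rw [← h]
  have := (abs_le.mp ht).2
  norm_num [Finset.sum_range_succ, cF, Nat.factorial] at this ⊢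
  linarith

theorem G_two : 0 ≤ PS cG 2 := by
  have h := (PS_summable cG cG_le 2).sum_add_tsum_nat_add 3
  have ht := tail_bound (fun k => cG (k + 3) * 2 ^ (k + 3)) (1 / 18) (by
    intro k
    have h1 := fac_tail k
    have h1' := fac_tail (k + 1)
    rw [show k + 1 + 3 = k + 3 + 1 by ring, pow_succ] at h1'
    rw [abs_mul, cG_abs, abs_of_nonneg (by positivity : (0 : ℝ) ≤ 2 ^ (k + 3))]
    have h4 : (4 : ℝ) ^ k = 2 ^ k * 2 ^ k := by rw [← mul_pow]; norm_num
    have h2 : (1 : ℝ) ≤ 2 ^ k := one_le_pow₀ (by norm_num)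
    have h3 : ((6 : ℝ) * (2 ^ k * 2 ^ k)) * (24 * (2 ^ k * 2 ^ k)) ≤
        ((k + 3).factorial : ℝ) * ((k + 3 + 1).factorial : ℝ) := by
      gcongr
      · linarith
      · linarith
    have h5 : (1 : ℝ) ≤ 2 ^ k * 2 ^ k := by nlinarith
    rw [one_div_pow, pow_add, div_mul_eq_mul_div, div_mul_div_comm,
      div_le_div_iff₀ (by positivity) (by positivity)]
    nlinarith)
  unfold PS
  rw [← h]
  have := (abs_le.mp ht).1
  norm_num [Finset.sum_range_succ, cG, Nat.factorial] at this ⊢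
  linarith

theorem exists_zero (a y : ℝ) (hy : 0 < y) (h : Psi a y ≤ 0) :
    ∃ x, 0 < x ∧ x ≤ y ∧ Psi a x = 0 := by
  have h1 := intermediate_value_Icc' hy.le (Psi_continuous a).continuousOn
  obtain ⟨x, hx, hx0⟩ := h1 ⟨h, by rw [Psi_zero]; norm_num⟩
  refine ⟨x, lt_of_le_of_ne hx.1 ?_, hx.2, hx0⟩
  rintro rfl
  rw [Psi_zero] at hx0
  norm_num at hx0

theorem exists_least (a : ℝ) (ha : a ∈ Set.Ioo (0 : ℝ) 1) :
    ∃ μ, IsLeast {x : ℝ | 0 < x ∧ Psi a x = 0} μ := by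
  have hs : {x : ℝ | 0 < x ∧ Psi a x = 0} = Set.Ici 0 ∩ Psi a ⁻¹' {0} := by
    ext x
    simp only [Set.mem_setOf_eq, Set.mem_inter_iff, Set.mem_Ici, Set.mem_preimage,
      Set.mem_singleton_iff]
    constructor
    · rintro ⟨h1, h2⟩
      exact ⟨h1.le, h2⟩
    · rintro ⟨h1, h2⟩
      refine ⟨lt_of_le_of_ne h1 ?_, h2⟩
      rintro rfl
      rw [Psi_zero] at h2
      norm_num at h2
  have hne : {x : ℝ | 0 < x ∧ Psi a x = 0}.Nonempty := by
    have h8 : (√8) ^ 2 = (8 : ℝ) := Real.sq_sqrt (by norm_num)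
    obtain ⟨x, hx, -, hx0⟩ := exists_zero a (√8) (by positivity) (by
      rw [Psi_eq, h8, show (8 : ℝ) / 4 = 2 by norm_num]
      have := Real.log_neg ha.1 ha.2
      nlinarith [F_two, G_two, mul_nonneg (neg_nonneg.mpr this.le) G_two])
    exact ⟨x, hx, hx0⟩
  refine ⟨_, IsClosed.isLeast_csInf ?_ hne ⟨0, fun x hx => hx.1.le⟩⟩
  rw [hs]
  exact isClosed_Ici.inter (isClosed_singleton.preimage (Psi_continuous a))

theorem mu_tendsto_zero (μ : ℝ → ℝ)
    (hμ : ∀ a ∈ Set.Ioo (0 : ℝ) 1, IsLeast {x : ℝ | 0 < x ∧ Psi a x = 0} (μ a)) :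
    Filter.Tendsto μ (nhdsWithin 0 (Set.Ioi 0)) (nhds 0) := by
  have hI : Set.Ioo (0 : ℝ) 1 ∈ nhdsWithin (0 : ℝ) (Set.Ioi 0) :=
    Ioo_mem_nhdsGT (by norm_num)
  rw [tendsto_order]
  constructor
  · intro b hb
    filter_upwards [hI] with a ha
    exact hb.trans (hμ a ha).1.1
  · intro b hb
    -- find a point below `b` where the second series is positive
    have hG : Filter.Tendsto (fun y : ℝ => PS cG (y ^ 2 / 4)) (nhdsWithin 0 (Set.Ioi 0))
        (nhds 1) := by
      have h2 := PS_continuous cG cG_le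
      have hc : Continuous (fun y : ℝ => PS cG (y ^ 2 / 4)) := by fun_prop
      have := hc.tendsto 0
      simp only [ne_eq, OfNat.ofNat_ne_zero, not_false_eq_true, zero_pow, zero_div,
        PS_G_zero] at this
      exact this.mono_left nhdsWithin_le_nhds
    obtain ⟨y, hyG, hy⟩ := ((hG.eventually (lt_mem_nhds (by norm_num : (0 : ℝ) < 1))).and
      (Ioo_mem_nhdsGT hb)).exists
    have hlog : ∀ᶠ a in nhdsWithin (0 : ℝ) (Set.Ioi 0),
        Real.log a ≤ - (PS cF (y ^ 2 / 4)) / (y ^ 2 * PS cG (y ^ 2 / 4)) :=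
      Real.tendsto_log_nhdsGT_zero.eventually (Filter.eventually_le_atBot _)
    filter_upwards [hI, hlog] with a ha hl
    have hy0 := hy.1
    have hpos : 0 < y ^ 2 * PS cG (y ^ 2 / 4) := by positivity
    rw [le_div_iff₀ hpos] at hl
    obtain ⟨x, hx, hxy, hx0⟩ := exists_zero a y hy.1 (by rw [Psi_eq]; linarith)
    exact ((hμ a ha).2 ⟨hx, hx0⟩).trans_lt (hxy.trans_lt hy.2)

/-- For every `a ∈ (0,1)` the function `Ψ_a` has a smallest positive zero `μ₁(a)`, and
`μ₁(a) √|log a| → 1` as `a → 0⁺`. -/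
theorem smallest_zero_Psi_asymptotics :
    (∀ a ∈ Set.Ioo (0 : ℝ) 1, ∃ μ, IsLeast {x : ℝ | 0 < x ∧ Psi a x = 0} μ) ∧
    ∀ μ : ℝ → ℝ,
      (∀ a ∈ Set.Ioo (0 : ℝ) 1, IsLeast {x : ℝ | 0 < x ∧ Psi a x = 0} (μ a)) →
      Filter.Tendsto (fun a : ℝ => μ a * Real.sqrt |Real.log a|)
        (nhdsWithin 0 (Set.Ioi 0)) (nhds 1) := by
  refine ⟨exists_least, fun μ hμ => ?_⟩
  have h0 := mu_tendsto_zero μ hμ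
  have hI : Set.Ioo (0 : ℝ) 1 ∈ nhdsWithin (0 : ℝ) (Set.Ioi 0) :=
    Ioo_mem_nhdsGT (by norm_num)
  have hF := PS_continuous cF cF_le
  have hG := PS_continuous cG cG_le
  have ht : Filter.Tendsto (fun a => μ a ^ 2 / 4) (nhdsWithin 0 (Set.Ioi 0)) (nhds 0) := by
    simpa using (h0.pow 2).div_const 4
  have hF' := (hF.tendsto 0).comp ht
  have hG' := (hG.tendsto 0).comp ht
  rw [PS_F_zero] at hF'
  rw [PS_G_zero] at hG'
  have hq := (hF'.div hG' one_ne_zero).sqrt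
  rw [div_one, Real.sqrt_one] at hq
  refine hq.congr' ?_
  filter_upwards [hI, hG'.eventually (lt_mem_nhds (by norm_num : (0 : ℝ) < 1))] with a ha hg
  have hz := (hμ a ha).1.2
  have hpos : 0 < μ a := (hμ a ha).1.1
  rw [Psi_eq] at hz
  simp only [Function.comp_apply, Pi.div_apply] at hg ⊢
  have he : PS cF (μ a ^ 2 / 4) / PS cG (μ a ^ 2 / 4) = μ a ^ 2 * |Real.log a| := by
    rw [abs_of_neg (Real.log_neg ha.1 ha.2), div_eq_iff hg.ne']
    linarith
  rw [he, Real.sqrt_mul (by positivity), Real.sqrt_sq hpos.le]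

end
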